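/- Let θ : ℕ → ℝ be a sequence of real numbers and for s > 0 and a positive integer N define c(s,N) = #{(j,k,i) : 1 ≤ j, k ≤ N, j ≠ k, i ∈ ℤ, |θ_j − θ_k + i| < s/(2N)}. Suppose there is a strictly increasing sequence of positive integers N₁ < N₂ < ... with lim_{m→∞} N_{m+1}/N_m = 1, such that for every smooth compactly supported f : ℝ → ℝ, lim_{m→∞} (1/N_m)·Σ_{1 ≤ j ≠ k ≤ N_m} Σ_{i ∈ ℤ} f(N_m·(θ_j − θ_k + i)) = ∫_{-∞}^{∞} f(x) dx. Then for every s > 0, lim_{N→∞} (1/N)·c(s,N) = s, where the limit is over all positive integers N. -/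

import Mathlib

open MeasureTheory Filter

/-- The pair count `c(s,N) = #{(j,k,i) : 1 ≤ j ≠ k ≤ N, i ∈ ℤ, |θ_j − θ_k + i| < s/(2N)}`. -/
noncomputable def pairCount (θ : ℕ → ℝ) (s : ℝ) (N : ℕ) : ℕ :=
  Set.ncard {t : ℕ × ℕ × ℤ |
    1 ≤ t.1 ∧ t.1 ≤ N ∧ 1 ≤ t.2.1 ∧ t.2.1 ≤ N ∧ t.1 ≠ t.2.1 ∧
    |θ t.1 - θ t.2.1 + (t.2.2 : ℝ)| < s / (2 * N)}

/-- The pair correlation function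
`R₂(f,N) = (1/N) · Σ_{1 ≤ j ≠ k ≤ N} Σ_{i ∈ ℤ} f(N·(θ_j − θ_k + i))`. -/
noncomputable def R2pc (θ : ℕ → ℝ) (f : ℝ → ℝ) (N : ℕ) : ℝ :=
  (1 / (N : ℝ)) * ∑ j ∈ Finset.Icc 1 N, ∑ k ∈ Finset.Icc 1 N,
    if j ≠ k then (∑' i : ℤ, f ((N : ℝ) * (θ j - θ k + (i : ℝ)))) else 0

/-- The number of triples `(j, k, i)` with `1 ≤ j ≠ k ≤ N` and `|θ_j − θ_k + i| < r`. -/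
noncomputable def closePairCount (θ : ℕ → ℝ) (r : ℝ) (N : ℕ) : ℕ :=
  ∑ j ∈ Finset.Icc 1 N, ∑ k ∈ Finset.Icc 1 N,
    if j ≠ k then Set.ncard {i : ℤ | |θ j - θ k + (i : ℝ)| < r} else 0

lemma finite_setOf_abs_add_intCast_lt (x r : ℝ) : {i : ℤ | |x + (i : ℝ)| < r}.Finite := by
  refine (Set.finite_Icc ⌊-x - r⌋ ⌈-x + r⌉).subset fun i hi ↦ ?_
  obtain ⟨h₁, h₂⟩ : -r < x + i ∧ x + i < r := abs_lt.1 (by simpa using hi)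
  constructor
  · have : (⌊-x - r⌋ : ℝ) ≤ i := (Int.floor_le _).trans (by linarith)
    exact_mod_cast this
  · have : (i : ℝ) ≤ ⌈-x + r⌉ := le_trans (by linarith) (Int.le_ceil _)
    exact_mod_cast this

lemma pairCount_eq_closePairCount (θ : ℕ → ℝ) (s : ℝ) (N : ℕ) :
    pairCount θ s N = closePairCount θ (s / (2 * N)) N := by
  classical
  let I : ℕ → ℕ → Finset ℤ := fun j k ↦
    (finite_setOf_abs_add_intCast_lt (θ j - θ k) (s / (2 * N))).toFinset
  let F : ℕ × ℕ → Finset (ℕ × ℕ × ℤ) := fun p ↦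
    if p.1 ≠ p.2 then (I p.1 p.2).image (fun i ↦ (p.1, p.2, i)) else ∅
  have hset : {t : ℕ × ℕ × ℤ | 1 ≤ t.1 ∧ t.1 ≤ N ∧ 1 ≤ t.2.1 ∧ t.2.1 ≤ N ∧ t.1 ≠ t.2.1 ∧
      |θ t.1 - θ t.2.1 + (t.2.2 : ℝ)| < s / (2 * N)} =
      ((Finset.Icc 1 N ×ˢ Finset.Icc 1 N).biUnion F : Finset (ℕ × ℕ × ℤ)) := by
    ext ⟨j, k, i⟩
    simp only [Set.mem_ofPred_eq, Finset.coe_biUnion, Set.mem_iUnion, Finset.mem_coe,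
      Finset.mem_product, Finset.mem_Icc, F, I, exists_prop, Prod.exists]
    constructor
    · rintro ⟨h1, h2, h3, h4, h5, h6⟩
      exact ⟨j, k, ⟨⟨h1, h2⟩, h3, h4⟩, by simp [h5, h6]⟩
    · rintro ⟨a, b, ⟨⟨h1, h2⟩, h3, h4⟩, h⟩
      split_ifs at h with hab
      · simp only [Finset.mem_image, Set.Finite.mem_toFinset, Set.mem_ofPred_eq,
          Prod.mk.injEq] at h
        obtain ⟨i', hi, rfl, rfl, rfl⟩ := h
        exact ⟨h1, h2, h3, h4, hab, hi⟩
      · simp at h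
  have hF : ∀ p, ∀ t ∈ F p, (t.1, t.2.1) = p := by
    intro p t ht
    simp only [F] at ht
    split_ifs at ht
    · obtain ⟨i, -, rfl⟩ := Finset.mem_image.1 ht
      rfl
    · simp at ht
  rw [pairCount, hset, Set.ncard_coe_finset, Finset.card_biUnion, Finset.sum_product,
    closePairCount]
  · refine Finset.sum_congr rfl fun j _ ↦ Finset.sum_congr rfl fun k _ ↦ ?_
    simp only [F]
    split_ifs
    · rw [Finset.card_image_of_injective _ fun a b h ↦ by simpa using h,
        ← Set.ncard_eq_toFinset_card _ (finite_setOf_abs_add_intCast_lt _ _)]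
    · rfl
  · intro p _ q _ hpq
    exact Finset.disjoint_left.2 fun t hp hq ↦ hpq ((hF p t hp).symm.trans (hF q t hq))

lemma closePairCount_mono (θ : ℕ → ℝ) {r r' : ℝ} {M N : ℕ} (hr : r ≤ r') (hMN : M ≤ N) :
    closePairCount θ r M ≤ closePairCount θ r' N := by
  have hsub : Finset.Icc 1 M ⊆ Finset.Icc 1 N := Finset.Icc_subset_Icc_right hMN
  refine (Finset.sum_le_sum fun j _ ↦ ?_).trans
    (Finset.sum_le_sum_of_subset_of_nonneg hsub fun _ _ _ ↦ Nat.zero_le _)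
  refine (Finset.sum_le_sum fun k _ ↦ ?_).trans
    (Finset.sum_le_sum_of_subset_of_nonneg hsub fun _ _ _ ↦ Nat.zero_le _)
  split_ifs
  · exact Set.ncard_le_ncard (fun i hi ↦ lt_of_lt_of_le hi hr)
      (finite_setOf_abs_add_intCast_lt _ _)
  · rfl

lemma Set.Finite.tsum_indicator_one {α : Type*} {S : Set α} (hS : S.Finite) :
    ∑' i, S.indicator (fun _ ↦ (1 : ℝ)) i = S.ncard := by
  classical
  rw [tsum_eq_sum (s := hS.toFinset) fun i hi ↦ by simpa using hi,
    Set.ncard_eq_toFinset_card S hS, Finset.card_eq_sum_ones, Nat.cast_sum]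
  exact Finset.sum_congr rfl fun i hi ↦ by simpa using hi

lemma summable_comp_mul_add_intCast {f : ℝ → ℝ} {b : ℝ} (hf : ∀ x, b ≤ |x| → f x = 0)
    {M : ℝ} (hM : 0 < M) (x : ℝ) : Summable fun i : ℤ ↦ f (M * (x + i)) := by
  refine summable_of_hasFiniteSupport
    ((finite_setOf_abs_add_intCast_lt x (b / M)).subset fun i hi ↦ ?_)
  by_contra h
  refine hi (hf _ ?_)
  rw [abs_mul, abs_of_pos hM, mul_comm, ← div_le_iff₀ hM]
  exact not_lt.1 h

lemma closePairCount_le_R2pc (θ : ℕ → ℝ) {f : ℝ → ℝ} {a b : ℝ} (h0 : ∀ x, 0 ≤ f x)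
    (h1 : ∀ x, |x| < a → 1 ≤ f x) (hb : ∀ x, b ≤ |x| → f x = 0) {M : ℕ} (hM : 0 < M) :
    (closePairCount θ (a / M) M : ℝ) ≤ M * R2pc θ f M := by
  have hM' : (0 : ℝ) < M := by exact_mod_cast hM
  rw [R2pc, ← mul_assoc, mul_one_div_cancel hM'.ne', one_mul, closePairCount]
  push_cast
  refine Finset.sum_le_sum fun j _ ↦ Finset.sum_le_sum fun k _ ↦ ?_
  split_ifs
  · have hfin := finite_setOf_abs_add_intCast_lt (θ j - θ k) (a / M)
    rw [← hfin.tsum_indicator_one]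
    refine Summable.tsum_le_tsum (fun i ↦ ?_)
      (summable_of_hasFiniteSupport (hfin.subset Set.support_indicator_subset))
      (summable_comp_mul_add_intCast hb hM' _)
    refine Set.indicator_apply_le' (fun hi ↦ h1 _ ?_) fun _ ↦ h0 _
    rw [abs_mul, abs_of_pos hM', mul_comm, ← lt_div_iff₀ hM']
    exact hi
  · simp

lemma R2pc_le_closePairCount (θ : ℕ → ℝ) {f : ℝ → ℝ} {b : ℝ} (h1 : ∀ x, f x ≤ 1)
    (hb : ∀ x, b ≤ |x| → f x = 0) {M : ℕ} (hM : 0 < M) :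
    M * R2pc θ f M ≤ closePairCount θ (b / M) M := by
  have hM' : (0 : ℝ) < M := by exact_mod_cast hM
  rw [R2pc, ← mul_assoc, mul_one_div_cancel hM'.ne', one_mul, closePairCount]
  push_cast
  refine Finset.sum_le_sum fun j _ ↦ Finset.sum_le_sum fun k _ ↦ ?_
  split_ifs
  · have hfin := finite_setOf_abs_add_intCast_lt (θ j - θ k) (b / M)
    rw [← hfin.tsum_indicator_one]
    refine Summable.tsum_le_tsum (fun i ↦ ?_) (summable_comp_mul_add_intCast hb hM' _)
      (summable_of_hasFiniteSupport (hfin.subset Set.support_indicator_subset))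
    refine Set.le_indicator_apply (fun _ ↦ h1 _) fun hi ↦ (hb _ ?_).le
    rw [abs_mul, abs_of_pos hM', mul_comm, ← div_le_iff₀ hM']
    exact not_lt.1 hi
  · simp

/-- A property which holds eventually along the gaps of `Nseq` holds for all large integers. -/
lemma StrictMono.eventually_of_gaps {u : ℕ → ℕ} (hu : StrictMono u) {p : ℕ → Prop}
    (h : ∀ᶠ m in atTop, ∀ n, u m ≤ n → n < u (m + 1) → p n) : ∀ᶠ n in atTop, p n := by
  obtain ⟨K, hK⟩ := eventually_atTop.1 h
  refine eventually_atTop.2 ⟨u K, fun n hn ↦ ?_⟩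
  have hex : ∃ m ≥ K, u m ≤ n ∧ n < u (m + 1) := by
    induction n, hn using Nat.le_induction with
    | base => exact ⟨K, le_rfl, le_rfl, hu K.lt_succ_self⟩
    | succ n _ ih =>
      obtain ⟨m, hmK, h1, h2⟩ := ih
      rcases (Nat.succ_le_of_lt h2).lt_or_eq with h3 | h3
      · exact ⟨m, hmK, h1.trans n.le_succ, h3⟩
      · exact ⟨m + 1, hmK.trans m.le_succ, h3.ge, h3.trans_lt (hu (m + 1).lt_succ_self)⟩
  obtain ⟨m, hmK, h1, h2⟩ := hex
  exact hK m hmK n h1 h2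

lemma exists_smooth_cutoff {a b : ℝ} (ha : 0 < a) (hab : a < b) :
    ∃ f : ℝ → ℝ, ContDiff ℝ (⊤ : ℕ∞) f ∧ HasCompactSupport f ∧ (∀ x, 0 ≤ f x) ∧
      (∀ x, f x ≤ 1) ∧ (∀ x, |x| < a → 1 ≤ f x) ∧ (∀ x, b ≤ |x| → f x = 0) ∧
      2 * a ≤ ∫ x, f x ∧ ∫ x, f x ≤ 2 * b := by
  let f : ContDiffBump (0 : ℝ) := ⟨a, b, ha, hab⟩
  refine ⟨f, f.contDiff, f.hasCompactSupport, fun x ↦ f.nonneg, fun x ↦ f.le_one,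
    fun x hx ↦ (f.one_of_mem_closedBall (by simpa using hx.le)).ge,
    fun x hx ↦ f.zero_of_le_dist (by simpa using hx), ?_, ?_⟩
  · have h := f.measure_closedBall_le_integral volume
    simpa [measureReal_def, f, ha.le] using h
  · have h := f.integral_le_measure_closedBall volume
    simpa [measureReal_def, f, (ha.trans hab).le] using h

/-- If the smoothed pair correlation converges to the Poisson limit
along a strictly increasing sequence `N₁ < N₂ < ⋯` of positive integers with
`N_{m+1}/N_m → 1`, for all smooth compactly supported test functions, then the
sharp-cutoff pair correlation `(1/N)·c(s,N)` converges to `s` along all integers `N`. -/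
theorem sharp_pair_correlation_of_smooth_subsequence
    (θ : ℕ → ℝ) (Nseq : ℕ → ℕ)
    (hmono : StrictMono Nseq) (hposseq : ∀ m : ℕ, 0 < Nseq m)
    (hratio : Tendsto (fun m : ℕ => (Nseq (m + 1) : ℝ) / (Nseq m : ℝ)) atTop (nhds 1))
    (hsub : ∀ f : ℝ → ℝ, ContDiff ℝ (⊤ : ℕ∞) f → HasCompactSupport f →
      Tendsto (fun m : ℕ => R2pc θ f (Nseq m)) atTop (nhds (∫ x : ℝ, f x))) :
    ∀ s : ℝ, 0 < s →
      Tendsto (fun N : ℕ => (pairCount θ s N : ℝ) / (N : ℝ)) atTop (nhds s) := by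
  intro s hs
  have hNpos : ∀ m, (0 : ℝ) < Nseq m := fun m ↦ by exact_mod_cast hposseq m
  refine tendsto_order.2 ⟨fun c hc ↦ ?_, fun c hc ↦ ?_⟩
  · rcases lt_or_ge c 0 with hc0 | hc0
    · exact Eventually.of_forall fun N ↦ hc0.trans_le (by positivity)
    obtain ⟨f, hf, hfc, -, hf1, -, hfb, hint, -⟩ :=
      exists_smooth_cutoff (a := c / 2 + (s - c) / 6) (b := c / 2 + (s - c) / 3)
        (by linarith) (by linarith)
    set b := c / 2 + (s - c) / 3
    have hlim := (hsub f hf hfc).div hratio one_ne_zero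
    have hE₁ := hlim.eventually_const_lt (u := c) (by linarith)
    have hE₂ := (hratio.const_mul b).eventually_lt_const (u := s / 2) (by simp only [b]; linarith)
    refine hmono.eventually_of_gaps ?_
    filter_upwards [hE₁, hE₂] with m h₁ h₂ N hmN hNm
    have hM := hNpos m
    have hM' := hNpos (m + 1)
    have hN : (0 : ℝ) < N := by exact_mod_cast (hposseq m).trans_le hmN
    have hNm' : (N : ℝ) ≤ Nseq (m + 1) := by exact_mod_cast hNm.le
    have hr : b / Nseq m ≤ s / (2 * N) := by
      rw [← mul_div_assoc, div_lt_iff₀ hM] at h₂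
      rw [div_le_div_iff₀ hM (by positivity)]
      have hb : 0 ≤ b := by simp only [b]; linarith
      nlinarith
    have hle : (Nseq m : ℝ) * R2pc θ f (Nseq m) ≤ pairCount θ s N := by
      rw [pairCount_eq_closePairCount]
      exact (R2pc_le_closePairCount θ hf1 hfb (hposseq m)).trans
        (by exact_mod_cast closePairCount_mono θ hr hmN)
    rw [Pi.div_apply, div_div_eq_mul_div, lt_div_iff₀ hM'] at h₁
    rw [lt_div_iff₀ hN]
    nlinarith
  · obtain ⟨f, hf, hfc, hf0, -, hfa, hfb, -, hint⟩ :=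
      exists_smooth_cutoff (a := s / 2 + (c - s) / 6) (b := s / 2 + (c - s) / 3)
        (by linarith) (by linarith)
    set a := s / 2 + (c - s) / 6
    have hlim := hratio.mul ((hsub f hf hfc).comp (tendsto_add_atTop_nat 1))
    have hE₁ := hlim.eventually_lt_const (u := c) (by linarith)
    have hE₂ := (hratio.const_mul (s / 2)).eventually_lt_const (u := a)
      (by simp only [a]; linarith)
    refine hmono.eventually_of_gaps ?_
    filter_upwards [hE₁, hE₂] with m h₁ h₂ N hmN hNm
    have hM := hNpos m
    have hM' := hNpos (m + 1)
    have hN : (0 : ℝ) < N := by exact_mod_cast (hposseq m).trans_le hmN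
    have hmN' : (Nseq m : ℝ) ≤ N := by exact_mod_cast hmN
    have hr : s / (2 * N) ≤ a / Nseq (m + 1) := by
      rw [← mul_div_assoc, div_lt_iff₀ hM] at h₂
      rw [div_le_div_iff₀ (by positivity) hM']
      have ha : 0 ≤ a := by simp only [a]; linarith
      nlinarith
    have hle : (pairCount θ s N : ℝ) ≤ Nseq (m + 1) * R2pc θ f (Nseq (m + 1)) := by
      rw [pairCount_eq_closePairCount]
      exact le_trans (by exact_mod_cast closePairCount_mono θ hr hNm.le)
        (closePairCount_le_R2pc θ hf0 hfa hfb (hposseq (m + 1)))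
    simp only [Function.comp_apply] at h₁
    rw [div_mul_eq_mul_div, div_lt_iff₀ hM] at h₁
    rw [div_lt_iff₀ hN]
    nlinarith
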